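/- Let A be a real von Neumann regular poring and let B be a real closure * of A. Then B is A-isomorphic to the integral closure of A in R/I, where R = ∏_{p ∈ Spec A} K_p is a product of real closed fields with each K_p algebraic over A/p and its ordering extending the image of A⁺ in A/p, and I is an ideal of R making the composite A → R → R/I an essential extension of A. -/

import Mathlib

universe u

/-- A partial ordering (positive cone) of a commutative ring: closed under addition and
multiplication, contains all squares, and intersects its negative only in `0`. -/
def IsPartialOrdering {A : Type*} [CommRing A] (P : Set A) : Prop :=
  (∀ a ∈ P, ∀ b ∈ P, a + b ∈ P) ∧ (∀ a ∈ P, ∀ b ∈ P, a * b ∈ P) ∧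
  (∀ a : A, a ^ 2 ∈ P) ∧ (∀ a ∈ P, -a ∈ P → a = 0)

/-- A (formally) real ring: a sum of squares vanishes only if each term vanishes. -/
def IsRealRing (A : Type*) [CommRing A] : Prop :=
  ∀ (n : ℕ) (f : Fin n → A), (∑ i, f i ^ 2) = 0 → ∀ i, f i = 0

/-- A von Neumann regular commutative ring. -/
def IsVonNeumannRegular (A : Type*) [CommRing A] : Prop :=
  ∀ a : A, ∃ b : A, a = a ^ 2 * b

/-- A Baer ring: the annihilator of every subset is generated by an idempotent. -/
def IsBaerRing (A : Type*) [CommRing A] : Prop :=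
  ∀ S : Set A, ∃ e : A, e * e = e ∧ ∀ x : A, (∀ s ∈ S, x * s = 0) ↔ ∃ y : A, x = e * y

/-- An essential (ring) extension: an injective ring homomorphism such that every nonzero
ideal of the codomain meets the image of the domain nontrivially. -/
def IsEssentialExtension {A B : Type*} [CommRing A] [CommRing B] (f : A →+* B) : Prop :=
  Function.Injective f ∧ ∀ J : Ideal B, J ≠ ⊥ → ∃ a : A, f a ∈ J ∧ f a ≠ 0

/-- A real ring is real closed * if it admits no proper essential integral extension
which is again a real ring. -/
def IsRealClosedStar (B : Type u) [CommRing B] : Prop :=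
  IsRealRing B ∧ ∀ (C : Type u) [CommRing C] (f : B →+* C),
    IsRealRing C → IsEssentialExtension f → f.IsIntegral → Function.Surjective f

/-- `(B, Q)` together with the embedding `f` is a real closure * of the poring `(A, P)`:
`B` is a real closed * ring, an essential and integral extension of `A`, whose partial
ordering `Q` extends `P`. -/
structure IsRealClosureStarOf (A : Type u) [CommRing A] (P : Set A)
    (B : Type u) [CommRing B] (Q : Set B) (f : A →+* B) : Prop where
  pos_partial : IsPartialOrdering Q
  rcs : IsRealClosedStar B
  essential : IsEssentialExtension f
  integral : f.IsIntegral
  mono : ∀ a ∈ P, f a ∈ Q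

/-- Bundled real closure * of a poring `(A, P)`. -/
structure RealClosureStar (A : Type u) [CommRing A] (P : Set A) : Type (u + 1) where
  carrier : Type u
  [ring : CommRing carrier]
  pos : Set carrier
  emb : A →+* carrier
  is : IsRealClosureStarOf A P carrier pos emb

attribute [instance] RealClosureStar.ring

/-- Two real closures * of `(A, P)` are `A`-isomorphic: there is a ring isomorphism over
`A` preserving the partial orderings in both directions. -/
def RealClosureStar.AIso {A : Type u} [CommRing A] {P : Set A}
    (B C : RealClosureStar A P) : Prop :=
  ∃ e : B.carrier ≃+* C.carrier, (∀ a : A, e (B.emb a) = C.emb a) ∧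
    ∀ b : B.carrier, b ∈ B.pos ↔ e b ∈ C.pos

/-- A poring `(A, P)` has a unique real closure *: one exists, and any two are
`A`-isomorphic as porings. -/
def HasUniqueRealClosureStar (A : Type u) [CommRing A] (P : Set A) : Prop :=
  Nonempty (RealClosureStar A P) ∧ ∀ B C : RealClosureStar A P, B.AIso C

/-- A prime cone of a commutative ring. -/
structure PrimeCone (A : Type u) [CommRing A] : Type u where
  carrier : Set A
  add_mem : ∀ a ∈ carrier, ∀ b ∈ carrier, a + b ∈ carrier
  mul_mem : ∀ a ∈ carrier, ∀ b ∈ carrier, a * b ∈ carrier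
  sq_mem : ∀ a : A, a ^ 2 ∈ carrier
  mem_or_neg_mem : ∀ a : A, a ∈ carrier ∨ -a ∈ carrier
  support : Ideal A
  mem_support : ∀ a : A, a ∈ support ↔ a ∈ carrier ∧ -a ∈ carrier
  support_isPrime : support.IsPrime

/-- The real spectrum of a poring `(A, P)`: the prime cones containing `P`. -/
def RealSpectrum (A : Type u) [CommRing A] (P : Set A) : Type u :=
  {α : PrimeCone A // P ⊆ α.carrier}

/-- A real closed field: formally real, every element or its negative is a square, and
every polynomial of odd degree has a root. -/
def IsRealClosedField (F : Type u) [Field F] : Prop :=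
  IsRealRing F ∧ (∀ x : F, (∃ y : F, y ^ 2 = x) ∨ ∃ y : F, y ^ 2 = -x) ∧
    ∀ p : Polynomial F, Odd p.natDegree → ∃ x : F, Polynomial.eval x p = 0

/-- A total ordering (positive cone) of a ring. -/
def IsTotalOrderingCone {K : Type*} [CommRing K] (T : Set K) : Prop :=
  (∀ a ∈ T, ∀ b ∈ T, a + b ∈ T) ∧ (∀ a ∈ T, ∀ b ∈ T, a * b ∈ T) ∧
  (∀ x : K, x ∈ T ∨ -x ∈ T) ∧ ∀ x ∈ T, -x ∈ T → x = 0

/-- The data `(K, κ)` is an epof (extension of product of fields) of the poring `(A, P)`: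
for each prime `p` of `A`, `K p` is a real closed field, algebraic over `Frac (A / p)`
(i.e. every element is algebraic over the image of `A` under `κ p`, whose kernel is `p`),
whose unique ordering (the squares) extends the image of `P` in `A / p`.  The epof itself
is the product `∀ p, K p` with the embedding `Pi.ringHom κ` and partial ordering the
squares. -/
structure IsEpof (A : Type u) [CommRing A] (P : Set A)
    (K : PrimeSpectrum A → Type u) [∀ p, Field (K p)] (κ : ∀ p, A →+* K p) : Prop where
  ker : ∀ (p : PrimeSpectrum A) (a : A), κ p a = 0 ↔ a ∈ p.asIdeal
  rcf : ∀ p, IsRealClosedField (K p)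
  alg : ∀ (p) (x : K p), ∃ q : Polynomial A,
    Polynomial.eval₂ (κ p) x q = 0 ∧ q.map (κ p) ≠ 0
  ordext : ∀ p, ∀ a ∈ P, ∃ y : K p, y ^ 2 = κ p a

/-- Witness that `B` (a real closure * of `(A, P)` via `f`) is `A`-isomorphic to the
integral closure of `A` in `R / I`, where `R = ∏_{p ∈ Spec A} K p` is an epof of `A`
and `I` is an ideal of `R` making `A → R → R / I` an essential extension of `A`. -/
structure EpofQuotientWitness (A : Type u) [CommRing A] (P : Set A)
    (B : Type u) [CommRing B] (f : A →+* B) : Type (u + 1) where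
  K : PrimeSpectrum A → Type u
  [fieldK : ∀ p, Field (K p)]
  κ : ∀ p, A →+* K p
  epof : IsEpof A P K κ
  I : Ideal (∀ p, K p)
  ess : IsEssentialExtension ((Ideal.Quotient.mk I).comp (Pi.ringHom κ))
  e : B →+* (∀ p, K p) ⧸ I
  inj : Function.Injective e
  comm : ∀ a : A, e (f a) = Ideal.Quotient.mk I (Pi.ringHom κ a)
  /-- the image of `B` is exactly the integral closure of `A` in `R / I` -/
  range_ic : Set.range e =
    {x : (∀ p, K p) ⧸ I | ((Ideal.Quotient.mk I).comp (Pi.ringHom κ)).IsIntegralElem x}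


theorem IsRealRing.isReduced {R : Type*} [CommRing R] (h : IsRealRing R) : IsReduced R := by
  refine isReduced_iff_pow_one_lt 2 (by norm_num) |>.2 fun x hx => ?_
  exact h 1 (fun _ => x) (by simpa using hx) 0

theorem IsVonNeumannRegular.isMaximal_of_isPrime {A : Type*} [CommRing A]
    (hA : IsVonNeumannRegular A) (p : Ideal A) (hp : p.IsPrime) : p.IsMaximal := by
  rw [Ideal.isMaximal_iff]
  refine ⟨p.ne_top_iff_one.1 hp.ne_top, fun J x hpJ hxp hxJ => ?_⟩
  obtain ⟨y, hy⟩ := hA x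
  have h : x * (1 - x * y) ∈ p := by
    rw [show x * (1 - x * y) = 0 by linear_combination hy]; exact p.zero_mem
  have h1 := hpJ ((hp.mem_or_mem h).resolve_left hxp)
  have := J.add_mem h1 (J.mul_mem_right y hxJ)
  simpa using this

/-- A reduced integral extension of a von Neumann regular ring is von Neumann regular. -/
theorem IsVonNeumannRegular.of_isIntegral {A B : Type*} [CommRing A] [CommRing B]
    (hA : IsVonNeumannRegular A) [IsReduced B] (f : A →+* B) (hf : f.IsIntegral) :
    IsVonNeumannRegular B := by
  have hmax : ∀ q : Ideal B, q.IsPrime → q.IsMaximal := fun q hq =>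
    Ideal.isMaximal_of_isIntegral_of_isMaximal_comap' f hf q
      (hA.isMaximal_of_isPrime _ (Ideal.comap_isPrime f q))
  have key : ∀ (m : Ideal B) [m.IsPrime], ∀ z ∈ m, ∃ s, s ∉ m ∧ s * z = 0 := by
    intro m _ z hz
    by_contra! h
    obtain ⟨q, hq, -, hqS⟩ := Ideal.exists_le_prime_disjoint (⊥ : Ideal B)
      (m.primeCompl ⊔ Submonoid.powers z) (Set.disjoint_left.2 fun w hw hwS => by
        obtain ⟨s, hs, _, ⟨n, rfl⟩, rfl⟩ := Submonoid.mem_sup.1 hwS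
        refine h s hs (eq_zero_of_pow_eq_zero (n := n + 1) ?_)
        rw [mul_pow, pow_succ s, pow_succ z]
        linear_combination (s ^ n * z) * Ideal.mem_bot.1 hw)
    have hqm : q ≤ m := fun w hw => by
      by_contra hwm
      exact Set.disjoint_left.1 hqS hw (Submonoid.mem_sup_left hwm)
    obtain rfl := (hmax q hq).eq_of_le (Ideal.IsPrime.ne_top ‹_›) hqm
    exact Set.disjoint_left.1 hqS hz (Submonoid.mem_sup_right (Submonoid.mem_powers z))
  intro x
  let J : Ideal B := Submodule.comap (LinearMap.mulRight B x) (Ideal.span {x ^ 2})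
  have hJ : J = ⊤ := by
    by_contra hne
    obtain ⟨m, hm, hJm⟩ := J.exists_le_maximal hne
    have hmp := hm.isPrime
    by_cases hx : x ∈ m
    · obtain ⟨s, hs, h⟩ := key m x hx
      exact hs (hJm (show s * x ∈ Ideal.span {x ^ 2} by rw [h]; exact Ideal.zero_mem _))
    · obtain ⟨y, z, hz, hyz⟩ := hm.exists_inv hx
      obtain ⟨s, hs, h⟩ := key m z hz
      exact hs (hJm (show s * x ∈ Ideal.span {x ^ 2} from Ideal.mem_span_singleton'.2
        ⟨s * y, by linear_combination (s * x) * hyz - x * h⟩))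
  have h1 : (1 : B) * x ∈ Ideal.span {x ^ 2} := show (1 : B) ∈ J from hJ ▸ Submodule.mem_top
  obtain ⟨b, hb⟩ := Ideal.mem_span_singleton'.1 h1
  exact ⟨b, by linear_combination -hb⟩

theorem IsRealRing.of_injective {R S : Type*} [CommRing R] [CommRing S] (hS : IsRealRing S)
    (g : R →+* S) (hg : Function.Injective g) : IsRealRing R := by
  intro n x hx i
  have := hS n (fun i => g (x i)) (by rw [← map_zero g, ← hx]; simp) i
  exact hg (by simpa using this)

theorem isRealRing_pi_quotient {ι : Type*} {K : ι → Type*} [∀ i, Field (K i)]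
    (hK : ∀ i, IsRealRing (K i)) (I : Ideal (∀ i, K i)) : IsRealRing ((∀ i, K i) ⧸ I) := by
  intro n x hx j
  choose y hy using fun i => Ideal.Quotient.mk_surjective (I := I) (x i)
  obtain rfl : (fun i => Ideal.Quotient.mk I (y i)) = x := funext hy
  have hs : (∑ i, y i ^ 2) ∈ I := by
    rw [← Ideal.Quotient.eq_zero_iff_mem]; simpa using hx
  refine Ideal.Quotient.eq_zero_iff_mem.2 ?_
  have : y j = (fun p => y j p * (∑ i, y i p ^ 2)⁻¹) * ∑ i, y i ^ 2 := by
    ext p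
    simp only [Pi.mul_apply, Finset.sum_apply, Pi.pow_apply]
    by_cases h : ∑ i, y i p ^ 2 = 0
    · simpa [h] using hK p n (fun i => y i p) h j
    · field_simp
  rw [this]
  exact I.mul_mem_left _ hs

/-- An ideal maximal among those meeting the domain trivially gives an essential extension. -/
theorem exists_ideal_isEssentialExtension {A R : Type*} [CommRing A] [CommRing R] (g : A →+* R)
    (hg : Function.Injective g) :
    ∃ I : Ideal R, IsEssentialExtension ((Ideal.Quotient.mk I).comp g) := by
  obtain ⟨I, -, hI⟩ := zorn_le_nonempty₀ {I : Ideal R | ∀ a, g a ∈ I → a = 0}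
    (fun c hc hchain J hJ => ⟨sSup c, fun a ha => by
      obtain ⟨K, hK, haK⟩ := (Submodule.mem_sSup_of_directed ⟨J, hJ⟩ hchain.directedOn).1 ha
      exact hc hK a haK, fun _ => le_sSup⟩)
    ⊥ (fun a ha => hg (by simpa using ha))
  refine ⟨I, (injective_iff_map_eq_zero _).2 fun a ha =>
    hI.prop a (Ideal.Quotient.eq_zero_iff_mem.1 ha), fun J hJ => ?_⟩
  by_contra! h
  refine hJ (le_bot_iff.1 ?_)
  have hle : I ≤ J.comap (Ideal.Quotient.mk I) := fun x hx => by
    rw [Ideal.mem_comap, Ideal.Quotient.eq_zero_iff_mem.2 hx]; exact J.zero_mem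
  have := hI.le_of_ge (y := J.comap (Ideal.Quotient.mk I))
    (fun a ha => hI.prop a (Ideal.Quotient.eq_zero_iff_mem.1 (h a ha))) hle
  intro x hx
  obtain ⟨y, rfl⟩ := Ideal.Quotient.mk_surjective x
  exact Ideal.Quotient.eq_zero_iff_mem.2 (this hx)

theorem injective_of_comp_injective_of_isEssentialExtension {A B S : Type*} [CommRing A]
    [CommRing B] [CommRing S] {f : A →+* B} (hf : IsEssentialExtension f) (g : B →+* S)
    (hg : Function.Injective (g.comp f)) : Function.Injective g := by
  rw [RingHom.injective_iff_ker_eq_bot]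
  by_contra h
  obtain ⟨a, ha, ha0⟩ := hf.2 _ h
  exact ha0 (by rw [hg (a₁ := a) (a₂ := 0) (by simpa using ha), map_zero])

/-- A von Neumann regular intermediate ring of an essential extension of `A` is itself an
essential extension of `A`. -/
theorem isEssentialExtension_of_comp {A C S : Type*} [CommRing A] [CommRing C] [CommRing S]
    (hC : IsVonNeumannRegular C) (h : A →+* C) (i : C →+* S) (hi : Function.Injective i)
    (hS : IsEssentialExtension (i.comp h)) : IsEssentialExtension h := by
  refine ⟨Function.Injective.of_comp (f := i) hS.1, fun J hJ => ?_⟩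
  obtain ⟨x, hxJ, hx⟩ := J.ne_bot_iff.1 hJ
  obtain ⟨y, hy⟩ := hC x
  obtain ⟨a, ha, ha0⟩ := hS.2 (Ideal.span {i x}) (by simpa [hi.eq_iff' (map_zero i)] using hx)
  obtain ⟨r, hr⟩ := Ideal.mem_span_singleton'.1 ha
  have : h a = h a * y * x := hi (by
    have := congrArg i hy
    simp only [RingHom.comp_apply, map_mul, map_pow] at hr this ⊢
    rw [← hr]
    linear_combination r * this)
  exact ⟨a, this ▸ J.mul_mem_left _ hxJ, fun h0 => ha0 (by simp [h0])⟩

theorem IsEssentialExtension.of_comp {A B C : Type*} [CommRing A] [CommRing B] [CommRing C]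
    {f : A →+* B} {g : B →+* C} (hg : Function.Injective g)
    (h : IsEssentialExtension (g.comp f)) : IsEssentialExtension g := by
  refine ⟨hg, fun J hJ => ?_⟩
  obtain ⟨a, ha, ha0⟩ := h.2 J hJ
  exact ⟨f a, ha, ha0⟩

theorem IsSumSq.map {R S : Type*} [CommRing R] [CommRing S] {a : R} (ha : IsSumSq a)
    (g : R →+* S) : IsSumSq (g a) := by
  induction ha with
  | zero => simp
  | sq_add b _ ih => simpa using IsSumSq.sq_add (g b) ih

theorem Polynomial.even_natDegree_of_isSumSq {L : Type*} [Field L] (hneg : ¬ IsSquare (-1 : L))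
    (hsum : ∀ a : L, IsSumSq a → IsSquare a) {G : Polynomial L} (hG : IsSumSq G) :
    G = 0 ∨ Even G.natDegree ∧ IsSquare G.leadingCoeff := by
  induction hG with
  | zero => exact .inl rfl
  | sq_add f hs ih =>
    rename_i G
    have hf : Even (f * f).natDegree ∧ IsSquare (f * f).leadingCoeff := by
      simp only [Polynomial.leadingCoeff_mul, IsSquare.mul_self, and_true]
      by_cases h : f = 0 <;> simp [h, Polynomial.natDegree_mul]
    by_cases hf0 : f = 0
    · simpa [hf0] using ih
    rcases ih with rfl | ⟨h1, h2⟩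
    · right; simpa using hf
    by_cases hG0 : G = 0
    · right; simpa [hG0] using hf
    right
    rcases lt_trichotomy (f * f).natDegree G.natDegree with h | h | h
    · rw [Polynomial.natDegree_add_eq_right_of_natDegree_lt h,
        Polynomial.leadingCoeff_add_of_degree_lt (Polynomial.degree_lt_degree h)]
      exact ⟨h1, h2⟩
    · have hlc : (f * f).leadingCoeff + G.leadingCoeff ≠ 0 := by
        obtain ⟨c, hc⟩ := h2
        rw [Polynomial.leadingCoeff_mul, hc]
        intro h0
        have hf1 : f.leadingCoeff ≠ 0 := by simpa using hf0
        refine hneg ⟨c / f.leadingCoeff, ?_⟩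
        field_simp
        linear_combination -h0
      have hd : (f * f).degree = G.degree := by
        rw [Polynomial.degree_eq_natDegree (mul_ne_zero hf0 hf0), h,
          Polynomial.degree_eq_natDegree hG0]
      refine ⟨?_, ?_⟩
      · rwa [Polynomial.natDegree_eq_of_degree_eq (q := G)
          ((Polynomial.degree_add_eq_of_leadingCoeff_add_ne_zero hlc).trans (by rw [hd, max_self]))]
      · rw [Polynomial.leadingCoeff_add_of_degree_eq hd hlc]
        exact hsum _ ((IsSquare.isSumSq hf.2).add h2.isSumSq)
    · rw [Polynomial.natDegree_add_eq_left_of_natDegree_lt h,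
        Polynomial.leadingCoeff_add_of_degree_lt' (Polynomial.degree_lt_degree h)]
      exact hf

theorem Polynomial.exists_isSumSq_natDegree_lt {L : Type*} [Field L] {p : Polynomial L}
    (hp : p.natDegree ≠ 0) {G : Polynomial L} (hG : IsSumSq G) :
    ∃ G', IsSumSq G' ∧ p ∣ G - G' ∧ G'.natDegree < 2 * p.natDegree := by
  induction hG with
  | zero => exact ⟨0, .zero, by simp, by simp; omega⟩
  | sq_add f hs ih =>
    obtain ⟨G', h1, ⟨k, hk⟩, h3⟩ := ih
    refine ⟨f % p * (f % p) + G', .sq_add _ h1, ⟨(f / p) * (f + f % p) + k, ?_⟩, ?_⟩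
    · linear_combination hk - (f + f % p) * EuclideanDomain.div_add_mod f p
    · refine (Polynomial.natDegree_add_le _ _).trans_lt (max_lt ?_ h3)
      have := Polynomial.natDegree_mod_lt f hp
      have := Polynomial.natDegree_mul_le (p := f % p) (q := f % p)
      omega

theorem Polynomial.exists_eval_eq_zero_of_odd_natDegree {L : Type*} [Field L]
    (hneg : ¬ IsSquare (-1 : L)) (hsum : ∀ a : L, IsSumSq a → IsSquare a)
    (hirr : ∀ p : Polynomial L, Irreducible p → (∀ x, p.eval x ≠ 0) →
      ∃ G, IsSumSq G ∧ p ∣ 1 + G)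
    (p : Polynomial L) (hp : Odd p.natDegree) : ∃ x, p.eval x = 0 := by
  induction hn : p.natDegree using Nat.strong_induction_on generalizing p with
  | _ n ih =>
  subst hn
  have hp0 : p ≠ 0 := by rintro rfl; simp at hp
  have hpn : p.natDegree ≠ 0 := fun h => by simp [h] at hp
  by_contra! hroot
  by_cases hi : Irreducible p
  · obtain ⟨G, hG, hpG⟩ := hirr p hi hroot
    obtain ⟨G', hG', hpG', hdeg⟩ := exists_isSumSq_natDegree_lt hpn hG
    have hG1 : IsSumSq (1 + G') := by simpa using IsSumSq.sq_add 1 hG'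
    have heval : ∀ x, (1 + G').eval x ≠ 0 := fun x hx => by
      refine hneg (hsum _ ?_)
      have : G'.eval x = -1 := by
        simp only [eval_add, eval_one] at hx; linear_combination hx
      rw [← this]
      exact hG'.map (evalRingHom x)
    have h0 : 1 + G' ≠ 0 := fun h => heval 0 (by simp [h])
    obtain ⟨h, hh⟩ : p ∣ 1 + G' := by
      have := dvd_sub hpG hpG'
      rwa [show 1 + G - (G - G') = 1 + G' by ring] at this
    have hh0 : h ≠ 0 := by rintro rfl; simp [h0] at hh
    have heven := ((even_natDegree_of_isSumSq hneg hsum hG1).resolve_left h0).1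
    have hlt : (1 + G').natDegree < 2 * p.natDegree :=
      (natDegree_add_le _ _).trans_lt (max_lt (by simp; omega) hdeg)
    rw [hh, natDegree_mul hp0 hh0] at heven hlt
    obtain ⟨x, hx⟩ := ih h.natDegree (by omega) h (by grind) rfl
    exact heval x (by rw [hh]; simp [hx])
  · have hu : ¬ IsUnit p := fun h => hpn (natDegree_eq_zero_of_isUnit h)
    rw [irreducible_iff] at hi
    push Not at hi
    obtain ⟨a, b, rfl, ha, hb⟩ := hi hu
    have ha0 := left_ne_zero_of_mul hp0
    have hb0 := right_ne_zero_of_mul hp0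
    have ha1 : 0 < a.natDegree := natDegree_pos_iff_degree_pos.2
      (degree_pos_of_ne_zero_of_nonunit ha0 ha)
    have hb1 : 0 < b.natDegree := natDegree_pos_iff_degree_pos.2
      (degree_pos_of_ne_zero_of_nonunit hb0 hb)
    rw [natDegree_mul ha0 hb0] at hp ih
    rcases Nat.even_or_odd a.natDegree with h | h
    · obtain ⟨x, hx⟩ := ih _ (by omega) b (by grind) rfl
      exact hroot x (by simp [hx])
    · obtain ⟨x, hx⟩ := ih _ (by omega) a h rfl
      exact hroot x (by simp [hx])

/-- The sums of squares of elements of `S` with weights in `T`. -/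
def weightedSumSq {R : Type*} [CommRing R] (T S : Set R) : AddSubmonoid R :=
  AddSubmonoid.closure {z | ∃ t ∈ T, ∃ y ∈ S, z = t * y ^ 2}

theorem mul_sq_mem_weightedSumSq {R : Type*} [CommRing R] {T S : Set R} {t y : R} (ht : t ∈ T)
    (hy : y ∈ S) : t * y ^ 2 ∈ weightedSumSq T S :=
  AddSubmonoid.subset_closure ⟨t, ht, y, hy, rfl⟩

theorem weightedSumSq_mono {R : Type*} [CommRing R] {T S S' : Set R} (h : S ⊆ S') :
    weightedSumSq T S ≤ weightedSumSq T S' :=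
  AddSubmonoid.closure_mono fun _ ⟨t, ht, y, hy, hz⟩ => ⟨t, ht, y, h hy, hz⟩

theorem mul_mem_weightedSumSq {R : Type*} [CommRing R] {T S : Set R}
    (hT : ∀ a ∈ T, ∀ b ∈ T, a * b ∈ T) (hS : ∀ a ∈ S, ∀ b ∈ S, a * b ∈ S) {x y : R}
    (hx : x ∈ weightedSumSq T S) (hy : y ∈ weightedSumSq T S) : x * y ∈ weightedSumSq T S := by
  induction hx using AddSubmonoid.closure_induction with
  | zero => simp
  | add a b _ _ iha ihb => rw [add_mul]; exact add_mem iha ihb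
  | mem a ha =>
    obtain ⟨t, ht, u, hu, rfl⟩ := ha
    induction hy using AddSubmonoid.closure_induction with
    | zero => simp
    | add a b _ _ iha ihb => rw [mul_add]; exact add_mem iha ihb
    | mem a ha =>
      obtain ⟨t', ht', u', hu', rfl⟩ := ha
      rw [show t * u ^ 2 * (t' * u' ^ 2) = (t * t') * (u * u') ^ 2 by ring]
      exact mul_sq_mem_weightedSumSq (hT _ ht _ ht') (hS _ hu _ hu')

theorem exists_maximal_neg_one_notMem_weightedSumSq {F Ω : Type*} [Field F] [Field Ω]
    [Algebra F Ω] {T : Set Ω}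
    (h : -1 ∉ weightedSumSq T ((⊥ : IntermediateField F Ω) : Set Ω)) :
    ∃ L : IntermediateField F Ω,
      Maximal (fun L : IntermediateField F Ω => -1 ∉ weightedSumSq T (L : Set Ω)) L := by
  have key : ∀ c : Set (IntermediateField F Ω), IsChain (· ≤ ·) c → c.Nonempty →
      ∀ x ∈ weightedSumSq T ((sSup c : IntermediateField F Ω) : Set Ω),
      ∃ L ∈ c, x ∈ weightedSumSq T (L : Set Ω) := by
    intro c hchain ⟨J, hJ⟩ x hx
    have : Nonempty c := ⟨⟨J, hJ⟩⟩
    have hdir : Directed (· ≤ ·) (fun i : c => (i : IntermediateField F Ω)) :=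
      hchain.directedOn.directed_val
    induction hx using AddSubmonoid.closure_induction with
    | zero => exact ⟨J, hJ, zero_mem _⟩
    | mem x hx =>
      obtain ⟨t, ht, y, hy, rfl⟩ := hx
      rw [sSup_eq_iSup', IntermediateField.coe_iSup_of_directed hdir, Set.mem_iUnion] at hy
      obtain ⟨L, hL⟩ := hy
      exact ⟨L, L.2, mul_sq_mem_weightedSumSq ht hL⟩
    | add x y _ _ hx hy =>
      obtain ⟨L, hL, hx⟩ := hx
      obtain ⟨L', hL', hy⟩ := hy
      obtain ⟨M, hM, h1, h2⟩ := hchain.directedOn L hL L' hL'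
      exact ⟨M, hM, add_mem (weightedSumSq_mono h1 hx) (weightedSumSq_mono h2 hy)⟩
  obtain ⟨L, -, hL⟩ := zorn_le_nonempty₀
    {L : IntermediateField F Ω | -1 ∉ weightedSumSq T (L : Set Ω)}
    (fun c hc hchain J hJ => ⟨sSup c, fun hmem =>
      have ⟨_, hL, h⟩ := key c hchain ⟨J, hJ⟩ _ hmem
      hc hL h, fun _ => le_sSup⟩) ⊥ h
  exact ⟨L, hL⟩

theorem neg_one_mem_weightedSumSq_range_aeval {F Ω : Type*} [Field F] [Field Ω] [Algebra F Ω]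
    [Algebra.IsAlgebraic F Ω] {T : Set Ω} {L : IntermediateField F Ω}
    (hL : Maximal (fun L : IntermediateField F Ω => -1 ∉ weightedSumSq T (L : Set Ω)) L)
    {s : Ω} (hs : s ∉ L) :
    -1 ∈ weightedSumSq T (Set.range (Polynomial.aeval (R := L) s)) := by
  have hlt : L ≤ (IntermediateField.adjoin L {s}).restrictScalars F := fun x hx =>
    (IntermediateField.adjoin L {s}).algebraMap_mem ⟨x, hx⟩
  by_contra hneg
  have hle := hL.le_of_ge (y := (IntermediateField.adjoin L {s}).restrictScalars F)
    (fun h => hneg (weightedSumSq_mono (fun x hx => ?_) h)) hlt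
  · exact hs (hle (IntermediateField.mem_adjoin_simple_self L s))
  have hx' : x ∈ (IntermediateField.adjoin L {s}).toSubalgebra := hx
  rw [IntermediateField.adjoin_simple_toSubalgebra_of_isAlgebraic
    (Algebra.IsAlgebraic.isAlgebraic s), Algebra.adjoin_singleton_eq_range_aeval] at hx'
  exact hx'

theorem weightedSumSq_subset_intermediateField {F Ω : Type*} [Field F] [Field Ω] [Algebra F Ω]
    {T : Set Ω} {L : IntermediateField F Ω} (hTL : T ⊆ L) {x : Ω}
    (hx : x ∈ weightedSumSq T (L : Set Ω)) : x ∈ L := by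
  induction hx using AddSubmonoid.closure_induction with
  | zero => exact L.zero_mem
  | mem x hx =>
    obtain ⟨t, ht, y, hy, rfl⟩ := hx
    exact mul_mem (hTL ht) (pow_mem hy 2)
  | add x y _ _ hx hy => exact L.add_mem hx hy

/-- A weighted sum of squares of polynomials in a square root `s` of `c`, expanded in `s`. -/
theorem exists_eq_add_of_mem_weightedSumSq_range_aeval {F Ω : Type*} [Field F] [Field Ω]
    [Algebra F Ω] {T : Set Ω} {L : IntermediateField F Ω} (hTL : T ⊆ L) {s : Ω} (hs : s ^ 2 ∈ L)
    {x : Ω} (hx : x ∈ weightedSumSq T (Set.range (Polynomial.aeval (R := L) s))) :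
    ∃ u ∈ weightedSumSq T (L : Set Ω), ∃ v ∈ weightedSumSq T (L : Set Ω), ∃ w ∈ L,
      x = u + s ^ 2 * v + w * s := by
  induction hx using AddSubmonoid.closure_induction with
  | zero => exact ⟨0, zero_mem _, 0, zero_mem _, 0, zero_mem _, by simp⟩
  | add x y _ _ hx hy =>
    obtain ⟨u, hu, v, hv, w, hw, rfl⟩ := hx
    obtain ⟨u', hu', v', hv', w', hw', rfl⟩ := hy
    exact ⟨_, add_mem hu hu', _, add_mem hv hv', _, add_mem hw hw', by ring⟩
  | mem x hx =>
    obtain ⟨t, ht, _, ⟨p, rfl⟩, rfl⟩ := hx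
    have hp : ∃ a ∈ L, ∃ b ∈ L, Polynomial.aeval s p = a + b * s := by
      induction p using Polynomial.induction_on' with
      | add p q hp hq =>
        obtain ⟨a, ha, b, hb, hp⟩ := hp
        obtain ⟨a', ha', b', hb', hq⟩ := hq
        exact ⟨_, add_mem ha ha', _, add_mem hb hb', by rw [map_add, hp, hq]; ring⟩
      | monomial n c =>
        rcases Nat.even_or_odd' n with ⟨k, rfl | rfl⟩
        · refine ⟨c * (s ^ 2) ^ k, mul_mem c.2 (pow_mem hs k), 0, zero_mem _, ?_⟩
          rw [Polynomial.aeval_monomial, IntermediateField.algebraMap_apply]; ring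
        · refine ⟨0, zero_mem _, c * (s ^ 2) ^ k, mul_mem c.2 (pow_mem hs k), ?_⟩
          rw [Polynomial.aeval_monomial, IntermediateField.algebraMap_apply]; ring
    obtain ⟨a, ha, b, hb, hp⟩ := hp
    refine ⟨_, mul_sq_mem_weightedSumSq ht ha, _, mul_sq_mem_weightedSumSq ht hb,
      t * (2 * a * b),
      mul_mem (hTL ht) (mul_mem (mul_mem (by simp) ha) hb), ?_⟩
    rw [hp]; ring

theorem exists_neg_one_eq_of_sq_mem {F Ω : Type*} [Field F] [Field Ω] [Algebra F Ω]
    [Algebra.IsAlgebraic F Ω] {T : Set Ω} {L : IntermediateField F Ω}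
    (hL : Maximal (fun L : IntermediateField F Ω => -1 ∉ weightedSumSq T (L : Set Ω)) L)
    (hTL : T ⊆ L) {s : Ω} (hs : s ^ 2 ∈ L) (hsL : s ∉ L) :
    ∃ u ∈ weightedSumSq T (L : Set Ω), ∃ v ∈ weightedSumSq T (L : Set Ω),
      -1 = u + s ^ 2 * v := by
  obtain ⟨u, hu, v, hv, w, hw, h⟩ := exists_eq_add_of_mem_weightedSumSq_range_aeval hTL hs
    (neg_one_mem_weightedSumSq_range_aeval hL hsL)
  refine ⟨u, hu, v, hv, ?_⟩
  by_cases hw0 : w = 0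
  · simpa [hw0] using h
  have hu' := weightedSumSq_subset_intermediateField hTL hu
  have hv' := weightedSumSq_subset_intermediateField hTL hv
  refine absurd ?_ hsL
  rw [show s = (-1 - u - s ^ 2 * v) / w by field_simp; linear_combination -h]
  exact div_mem (sub_mem (sub_mem (neg_mem (one_mem L)) hu') (mul_mem hs hv')) hw

/-- Every proper preordering of a field extends to the squares of some algebraic real closed
extension field. -/
theorem exists_isRealClosedField {F : Type u} [Field F] (T : Set F)
    (hadd : ∀ a ∈ T, ∀ b ∈ T, a + b ∈ T) (hmul : ∀ a ∈ T, ∀ b ∈ T, a * b ∈ T)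
    (hsq : ∀ a : F, a ^ 2 ∈ T) (hneg : -1 ∉ T) :
    ∃ L : IntermediateField F (AlgebraicClosure F), IsRealClosedField L ∧
      ∀ t ∈ T, ∃ y : L, y ^ 2 = algebraMap F L t := by
  set Ω := AlgebraicClosure F
  set W : Set Ω := algebraMap F Ω '' T
  have hWmul : ∀ a ∈ W, ∀ b ∈ W, a * b ∈ W := by
    rintro _ ⟨a, ha, rfl⟩ _ ⟨b, hb, rfl⟩
    exact ⟨a * b, hmul a ha b hb, map_mul _ _ _⟩
  have hW1 : (1 : Ω) ∈ W := ⟨1, by simpa using hsq 1, map_one _⟩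
  obtain ⟨L, hL⟩ := exists_maximal_neg_one_notMem_weightedSumSq (F := F) (T := W) (by
    intro h
    have key : ∀ x ∈ weightedSumSq W ((⊥ : IntermediateField F Ω) : Set Ω), x ∈ W := by
      intro x hx
      induction hx using AddSubmonoid.closure_induction with
      | zero => exact ⟨0, by simpa using hsq 0, map_zero _⟩
      | add x y _ _ hx hy =>
        obtain ⟨a, ha, rfl⟩ := hx
        obtain ⟨b, hb, rfl⟩ := hy
        exact ⟨a + b, hadd a ha b hb, map_add _ _ _⟩
      | mem x hx =>
        obtain ⟨t, ht, y, hy, rfl⟩ := hx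
        obtain ⟨y, rfl⟩ := IntermediateField.mem_bot.1 hy
        exact hWmul _ ht _ ⟨y ^ 2, hsq y, map_pow _ _ _⟩
    obtain ⟨t, ht, ht1⟩ := key _ h
    have : t = -1 := (algebraMap F Ω).injective (by simpa using ht1)
    exact hneg (this ▸ ht))
  have hWL : W ⊆ L := by
    rintro _ ⟨t, -, rfl⟩
    exact L.algebraMap_mem t
  have hLneg : -1 ∉ weightedSumSq W (L : Set Ω) := hL.prop
  have hCmul : ∀ {x y : Ω}, x ∈ weightedSumSq W (L : Set Ω) → y ∈ weightedSumSq W (L : Set Ω) →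
      x * y ∈ weightedSumSq W (L : Set Ω) := fun hx hy =>
    mul_mem_weightedSumSq hWmul (fun _ ha _ hb => L.mul_mem ha hb) hx hy
  have hCsq : ∀ y : L, (y : Ω) ^ 2 ∈ weightedSumSq W (L : Set Ω) := fun y => by
    simpa using mul_sq_mem_weightedSumSq hW1 y.2
  have hCsq' : ∀ x : L, (x : Ω) ∈ weightedSumSq W (L : Set Ω) → ∃ y : L, y ^ 2 = x := by
    intro x hx
    obtain ⟨s, hs⟩ := IsAlgClosed.exists_pow_nat_eq (x : Ω) (n := 2) (by norm_num)
    by_cases hsL : s ∈ L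
    · exact ⟨⟨s, hsL⟩, Subtype.ext hs⟩
    obtain ⟨u, hu, v, hv, h⟩ := exists_neg_one_eq_of_sq_mem hL hWL (hs ▸ x.2) hsL
    rw [h, hs] at hLneg
    exact absurd (add_mem hu (hCmul hx hv)) hLneg
  have hsumC : ∀ a : L, IsSumSq a → (a : Ω) ∈ weightedSumSq W (L : Set Ω) := by
    intro a ha
    induction ha with
    | zero => exact zero_mem _
    | sq_add b _ ih => simpa [pow_two] using add_mem (hCsq b) ih
  have hsum : ∀ a : L, IsSumSq a → IsSquare a := fun a ha => by
    obtain ⟨y, hy⟩ := hCsq' a (hsumC a ha)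
    exact ⟨y, by rw [← hy, pow_two]⟩
  have hsumneg : ¬ IsSumSq (-1 : L) := fun h => hLneg (by simpa using hsumC _ h)
  refine ⟨L, ⟨?_, ?_, ?_⟩, ?_⟩
  · intro n x hx j
    by_contra hj
    refine hsumneg ?_
    have hx' := Finset.add_sum_erase Finset.univ (fun i => x i ^ 2) (Finset.mem_univ j)
    rw [show (-1 : L) = ∑ i ∈ Finset.univ.erase j, (x i / x j) ^ 2 by
      simp only [div_pow, ← Finset.sum_div]
      rw [eq_div_iff (pow_ne_zero 2 hj)]
      linear_combination -hx - hx']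
    exact IsSumSq.sum_sq _ _
  · intro x
    obtain ⟨s, hs⟩ := IsAlgClosed.exists_pow_nat_eq (x : Ω) (n := 2) (by norm_num)
    by_cases hsL : s ∈ L
    · exact .inl ⟨⟨s, hsL⟩, Subtype.ext hs⟩
    obtain ⟨u, hu, v, hv, h⟩ := exists_neg_one_eq_of_sq_mem hL hWL (hs ▸ x.2) hsL
    refine .inr (hCsq' (-x) ?_)
    rw [hs] at h
    have hv0 : v ≠ 0 := by
      rintro rfl
      exact hLneg (by rw [h]; simpa using hu)
    have hvL := weightedSumSq_subset_intermediateField hWL hv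
    rw [show ((-x : L) : Ω) = (1 + u) * v * (v⁻¹) ^ 2 by
      push_cast; field_simp; linear_combination h]
    refine hCmul (hCmul (add_mem (by simpa using hCsq 1) hu) hv) (hCsq ⟨v⁻¹, inv_mem hvL⟩)
  · refine Polynomial.exists_eval_eq_zero_of_odd_natDegree (fun h => hsumneg h.isSumSq) hsum ?_
    intro p hp hroot
    obtain ⟨s, hs⟩ := IsAlgClosed.exists_aeval_eq_zero Ω p (Polynomial.degree_ne_of_natDegree_ne
      hp.natDegree_pos.ne')
    have hsL : s ∉ L := fun h => hroot ⟨s, h⟩ (Subtype.ext (by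
      have := Polynomial.aeval_algebraMap_apply Ω (⟨s, h⟩ : L) p
      rw [IntermediateField.algebraMap_apply, hs] at this
      simpa using this.symm))
    have key : ∀ x ∈ weightedSumSq W (Set.range (Polynomial.aeval (R := L) s)),
        ∃ G : Polynomial L, IsSumSq G ∧ Polynomial.aeval s G = x := by
      intro x hx
      induction hx using AddSubmonoid.closure_induction with
      | zero => exact ⟨0, .zero, map_zero _⟩
      | add x y _ _ hx hy =>
        obtain ⟨G, hG, rfl⟩ := hx
        obtain ⟨H, hH, rfl⟩ := hy
        exact ⟨G + H, hG.add hH, map_add _ _ _⟩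
      | mem x hx =>
        obtain ⟨t, ht, _, ⟨q, rfl⟩, rfl⟩ := hx
        obtain ⟨y, hy⟩ := hCsq' ⟨t, hWL ht⟩ (by simpa using mul_sq_mem_weightedSumSq ht L.one_mem)
        refine ⟨(Polynomial.C y * q) * (Polynomial.C y * q), IsSumSq.mul_self _, ?_⟩
        have hy' : (y : Ω) ^ 2 = t := congrArg Subtype.val hy
        simp only [map_mul, Polynomial.aeval_C, IntermediateField.algebraMap_apply]
        rw [← hy']; ring
    obtain ⟨G, hG, hGs⟩ := key _ (neg_one_mem_weightedSumSq_range_aeval hL hsL)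
    refine ⟨G, hG, ?_⟩
    have hint : IsIntegral L s := Algebra.IsIntegral.isIntegral s
    exact ((minpoly.irreducible hint).dvd_symm hp (minpoly.dvd _ _ hs)).trans
      (minpoly.dvd _ _ (by simp [hGs]))
  · intro t ht
    refine hCsq' _ ?_
    simpa using mul_sq_mem_weightedSumSq (T := W) ⟨t, ht, rfl⟩ L.one_mem

/-- A residue field of `B` at a maximal ideal embeds in a real closed field in which all elements
of a partial ordering of `B` become squares. -/
theorem exists_isRealClosedField_of_isMaximal {B : Type u} [CommRing B]
    (hB : IsVonNeumannRegular B) {Q : Set B} (hQ : IsPartialOrdering Q) (q : Ideal B)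
    [q.IsMaximal] :
    ∃ (K : Type u) (_ : Field K) (g : B →+* K), IsRealClosedField K ∧ g.IsIntegral ∧
      RingHom.ker g = q ∧ ∀ b ∈ Q, ∃ y, y ^ 2 = g b := by
  let : Field (B ⧸ q) := Ideal.Quotient.field q
  obtain ⟨hadd, hmul, hsq, hneg⟩ := hQ
  obtain ⟨L, hL, hLQ⟩ := exists_isRealClosedField (Ideal.Quotient.mk q '' Q)
    (by
      rintro _ ⟨a, ha, rfl⟩ _ ⟨b, hb, rfl⟩
      exact ⟨a + b, hadd a ha b hb, map_add _ _ _⟩)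
    (by
      rintro _ ⟨a, ha, rfl⟩ _ ⟨b, hb, rfl⟩
      exact ⟨a * b, hmul a ha b hb, map_mul _ _ _⟩)
    (fun a => by
      obtain ⟨b, rfl⟩ := Ideal.Quotient.mk_surjective a
      exact ⟨b ^ 2, hsq b, map_pow _ _ _⟩)
    (by
      rintro ⟨s, hs, h⟩
      have hmem : 1 + s ∈ q := by
        rw [← Ideal.Quotient.eq_zero_iff_mem, map_add, h, map_one, add_neg_cancel]
      obtain ⟨y, hy⟩ := hB (1 + s)
      have he := hneg _ (hsq (1 - (1 + s) * y)) (by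
        rw [show -(1 - (1 + s) * y) ^ 2 = s * (1 - (1 + s) * y) ^ 2 by
          linear_combination ((1 + s) * y - 1) * hy]
        exact hmul _ hs _ (hsq _))
      have h1 : 1 - (1 + s) * y ∈ q :=
        Ideal.IsPrime.mem_of_pow_mem ‹q.IsMaximal›.isPrime 2 (he ▸ q.zero_mem)
      refine (q.ne_top_iff_one.1 ‹q.IsMaximal›.ne_top) ?_
      simpa using q.add_mem h1 (q.mul_mem_right y hmem))
  refine ⟨L, inferInstance, (algebraMap (B ⧸ q) L).comp (Ideal.Quotient.mk q), hL, ?_, ?_,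
    fun b hb => hLQ _ ⟨b, hb, rfl⟩⟩
  · exact RingHom.IsIntegral.trans _ _
      (RingHom.isIntegral_of_surjective _ Ideal.Quotient.mk_surjective)
      (algebraMap_isIntegral_iff.2 (Algebra.IsAlgebraic.isIntegral (K := B ⧸ q) (A := L)))
  · rw [RingHom.ker_comp_of_injective _ (algebraMap (B ⧸ q) L).injective, Ideal.mk_ker]

theorem IsRealRing.injective_pi_of_ker_eq {A : Type u} [CommRing A] (hA : IsRealRing A)
    {K : PrimeSpectrum A → Type*} [∀ p, CommRing (K p)] (κ : ∀ p, A →+* K p)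
    (hκ : ∀ p a, κ p a = 0 ↔ a ∈ p.asIdeal) : Function.Injective (Pi.ringHom κ) := by
  have := hA.isReduced
  refine (injective_iff_map_eq_zero _).2 fun a ha => ?_
  refine (nilpotent_iff_mem_prime.2 fun p hp => ?_).eq_zero
  exact (hκ ⟨p, hp⟩ a).1 (congrFun ha _)

/-- If `(A, P)` is a real von Neumann regular poring and `(B, Q, f)` is
a real closure * of `A`, then `B` is `A`-isomorphic to the integral closure of `A` in
`R / I` for some epof `R = ∏_{p ∈ Spec A} K p` of `A` and some ideal `I` of `R` making
`A → R → R / I` an essential extension of `A`. -/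
theorem realClosureStar_eq_integralClosure_in_epof_quotient
    (A : Type u) [CommRing A] (P : Set A) (hP : IsPartialOrdering P)
    (hreal : IsRealRing A) (hvnr : IsVonNeumannRegular A)
    (B : Type u) [CommRing B] (Q : Set B) (f : A →+* B)
    (hB : IsRealClosureStarOf A P B Q f) :
    Nonempty (EpofQuotientWitness A P B f) := by
  have hBred := hB.rcs.1.isReduced
  have hBvnr := hvnr.of_isIntegral f hB.integral
  have hex : ∀ p : PrimeSpectrum A, ∃ (K : Type u) (_ : Field K) (g : B →+* K),
      IsRealClosedField K ∧ g.IsIntegral ∧ (∀ a, g (f a) = 0 ↔ a ∈ p.asIdeal) ∧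
      ∀ b ∈ Q, ∃ y, y ^ 2 = g b := by
    intro p
    let := f.toAlgebra
    have : Algebra.IsIntegral A B := ⟨hB.integral⟩
    obtain ⟨q, -, hq, hqp⟩ := Ideal.exists_ideal_over_prime_of_isIntegral (S := B) p.asIdeal ⊥
      (fun a ha => by
        have : f a = 0 := Ideal.mem_bot.1 (Ideal.mem_comap.1 ha)
        rw [hB.essential.1 (this.trans (map_zero f).symm)]
        exact p.asIdeal.zero_mem)
    have := hBvnr.isMaximal_of_isPrime q hq
    obtain ⟨K, _, g, h1, h2, h3, h4⟩ :=
      exists_isRealClosedField_of_isMaximal hBvnr hB.pos_partial q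
    refine ⟨K, _, g, h1, h2, fun a => ?_, h4⟩
    rw [← RingHom.mem_ker, h3, ← hqp]
    rfl
  choose K _ g hrcf hint hker hsq using hex
  have hepof : IsEpof A P K (fun p => (g p).comp f) := by
    refine ⟨hker, hrcf, fun p x => ?_, fun p a ha => hsq p _ (hB.mono a ha)⟩
    obtain ⟨q, hq, hx⟩ := hB.integral.trans _ _ (hint p) x
    exact ⟨q, hx, (hq.map _).ne_zero⟩
  obtain ⟨I, hI⟩ := exists_ideal_isEssentialExtension _
    (hreal.injective_pi_of_ker_eq (fun p => (g p).comp f) hker)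
  set ι := (Ideal.Quotient.mk I).comp (Pi.ringHom fun p => (g p).comp f)
  set e : B →+* (∀ p, K p) ⧸ I := (Ideal.Quotient.mk I).comp (Pi.ringHom g)
  have he : Function.Injective e :=
    injective_of_comp_injective_of_isEssentialExtension hB.essential e hI.1
  have hmem : ∀ b, ι.IsIntegralElem (e b) := fun b => (hB.integral b).map e
  refine ⟨⟨K, _, hepof, I, hI, e, he, fun _ => rfl, ?_⟩⟩
  ext x
  refine ⟨?_, fun hx => ?_⟩
  · rintro ⟨b, rfl⟩
    exact hmem b
  let := ι.toAlgebra
  let C := integralClosure A ((∀ p, K p) ⧸ I)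
  have hCreal : IsRealRing C :=
    (isRealRing_pi_quotient (fun p => (hrcf p).1) I).of_injective C.val.toRingHom
      Subtype.val_injective
  have hCred := hCreal.isReduced
  have hCint : (algebraMap A C).IsIntegral := fun x => Algebra.IsIntegral.isIntegral x
  have hCess : IsEssentialExtension (algebraMap A C) :=
    isEssentialExtension_of_comp (hvnr.of_isIntegral _ hCint) _ C.val.toRingHom
      Subtype.val_injective hI
  let e' : B →+* C := e.codRestrict C hmem
  have he' : Function.Injective e' := fun a b hab => he (congrArg Subtype.val hab)
  have hcomp : e'.comp f = algebraMap A C := rfl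
  obtain ⟨b, hb⟩ := hB.rcs.2 C e' hCreal (.of_comp he' (hcomp ▸ hCess))
    (RingHom.IsIntegral.tower_top f e' (hcomp ▸ hCint)) ⟨x, hx⟩
  exact ⟨b, congrArg Subtype.val hb⟩
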